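/- Let (S, P) be a finite Markov chain, T ⊆ S a target set, and S₀ the set of states from which no directed path in the transition graph leads to T. For an arbitrary initial vector v₀ : S → ℝ, define the iterates v_{n+1}(s) = 1 for s ∈ T, v_{n+1}(s) = 0 for s ∈ S₀, and v_{n+1}(s) = Σ_{s'∈S} P(s,s') v_n(s') for s ∈ S ∖ (T ∪ S₀). Then for every state s ∈ S, lim_{n→∞} v_n(s) = ℙ_s(◇T). In particular, value iteration started from any lower or upper bound (e.g. v₀ ≡ 0 or v₀ ≡ 1 outside S₀) converges to the reachability probabilities. -/

import Mathlib

open Finset Filter Topology MeasureTheory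

/-- `P` is a row-stochastic transition matrix. -/
def IsStochastic {S : Type*} [Fintype S] (P : Matrix S S ℝ) : Prop :=
  (∀ s s', 0 ≤ P s s') ∧ ∀ s, ∑ s', P s s' = 1

section Killed

variable {S : Type*} [Fintype S] {P : Matrix S S ℝ} {B : Set S}

/-- The survival probabilities of the chain `P` killed on `B`: `survival P B n s` is the probability
that the chain started at `s` avoids `B` for `n` steps. -/
noncomputable def survival (P : Matrix S S ℝ) (B : Set S) : ℕ → S → ℝ
  | 0, _ => 1
  | n + 1, s => open Classical in if s ∈ B then 0 else ∑ s', P s s' * survival P B n s'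

lemma survival_succ_of_mem {s : S} (hs : s ∈ B) (n : ℕ) : survival P B (n + 1) s = 0 := by
  simp [survival, hs]

lemma survival_succ_of_notMem {s : S} (hs : s ∉ B) (n : ℕ) :
    survival P B (n + 1) s = ∑ s', P s s' * survival P B n s' := by
  simp [survival, hs]

lemma survival_nonneg (hP : IsStochastic P) (n : ℕ) (s : S) : 0 ≤ survival P B n s := by
  induction n generalizing s with
  | zero => simp [survival]
  | succ n ih =>
    by_cases hs : s ∈ B
    · rw [survival_succ_of_mem hs]
    · rw [survival_succ_of_notMem hs]
      exact Finset.sum_nonneg fun s' _ => mul_nonneg (hP.1 s s') (ih s')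

lemma survival_succ_le (hP : IsStochastic P) (n : ℕ) (s : S) :
    survival P B (n + 1) s ≤ survival P B n s := by
  induction n generalizing s with
  | zero =>
    by_cases hs : s ∈ B
    · simp [survival, hs]
    · simp [survival, hs, hP.2 s]
  | succ n ih =>
    by_cases hs : s ∈ B
    · rw [survival_succ_of_mem hs, survival_succ_of_mem hs]
    · rw [survival_succ_of_notMem hs, survival_succ_of_notMem hs]
      exact Finset.sum_le_sum fun s' _ => mul_le_mul_of_nonneg_left (ih s') (hP.1 s s')

/-- Maximum principle: a function that vanishes on `B` and is harmonic off `B` is nonpositive if `B`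
can be reached from every state. -/
lemma nonpos_of_harmonic (hP : IsStochastic P)
    (hB : ∀ s, ∃ t ∈ B, Relation.ReflTransGen (fun x y => 0 < P x y) s t)
    {r : S → ℝ} (hr0 : ∀ s ∈ B, r s = 0) (hr : ∀ s ∉ B, r s = ∑ s', P s s' * r s') (s : S) :
    r s ≤ 0 := by
  have : Nonempty S := ⟨s⟩
  obtain ⟨m, hm⟩ := Finite.exists_max r
  refine (hm s).trans ?_
  by_contra! hpos
  have hsucc {x y : S} (hx : r x = r m) (hxy : 0 < P x y) : r y = r m := by
    have hxB : x ∉ B := fun h => hpos.ne' (hx.symm.trans (hr0 x h))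
    have hsum : ∑ s', P x s' * (r m - r s') = 0 := by
      simp_rw [mul_sub, Finset.sum_sub_distrib, ← Finset.sum_mul, hP.2 x, ← hr x hxB, hx]
      ring
    have hy := (Finset.sum_eq_zero_iff_of_nonneg fun s' _ =>
      mul_nonneg (hP.1 x s') (sub_nonneg.2 (hm s'))).1 hsum y (Finset.mem_univ y)
    linarith [(mul_eq_zero.1 hy).resolve_left hxy.ne']
  obtain ⟨t, htB, hmt⟩ := hB m
  have hconst : r t = r m := by
    clear htB
    induction hmt with
    | refl => rfl
    | tail _ hxy ih => exact hsucc ih hxy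
  exact hpos.ne' (hconst.symm.trans (hr0 t htB))

lemma tendsto_survival (hP : IsStochastic P)
    (hB : ∀ s, ∃ t ∈ B, Relation.ReflTransGen (fun x y => 0 < P x y) s t) (s : S) :
    Tendsto (fun n => survival P B n s) atTop (𝓝 0) := by
  have hanti (s : S) : Antitone fun n => survival P B n s :=
    antitone_nat_of_succ_le fun n => survival_succ_le hP n s
  have hbdd (s : S) : BddBelow (Set.range fun n => survival P B n s) :=
    ⟨0, by rintro _ ⟨n, rfl⟩; exact survival_nonneg hP n s⟩
  have hlim (s : S) := tendsto_atTop_ciInf (hanti s) (hbdd s)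
  have hle := nonpos_of_harmonic hP hB (r := fun s => ⨅ n, survival P B n s)
    (fun s hs => tendsto_nhds_unique ((tendsto_add_atTop_iff_nat 1).2 (hlim s))
      (by simp [survival_succ_of_mem hs]))
    (fun s hs => tendsto_nhds_unique ((tendsto_add_atTop_iff_nat 1).2 (hlim s))
      (by
        simp_rw [survival_succ_of_notMem hs]
        exact tendsto_finsetSum _ fun s' _ => (hlim s').const_mul _))
  have hge : 0 ≤ ⨅ n, survival P B n s := le_ciInf fun n => survival_nonneg hP n s
  have h := hlim s
  rwa [le_antisymm (hle s) hge] at h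

/-- Iterating a stochastic matrix killed on a set `B` that is reachable from everywhere drives
every vector to zero. -/
lemma tendsto_zero_of_killed_iterate (hP : IsStochastic P)
    (hB : ∀ s, ∃ t ∈ B, Relation.ReflTransGen (fun x y => 0 < P x y) s t)
    {e : ℕ → S → ℝ} (he0 : ∀ n, ∀ s ∈ B, e (n + 1) s = 0)
    (he : ∀ n, ∀ s ∉ B, e (n + 1) s = ∑ s', P s s' * e n s') (s : S) :
    Tendsto (fun n => e n s) atTop (𝓝 0) := by
  set C := ∑ s, |e 0 s|
  have hbound (n : ℕ) (s : S) : |e n s| ≤ C * survival P B n s := by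
    induction n generalizing s with
    | zero =>
      simpa [survival] using
        Finset.single_le_sum (f := fun s => |e 0 s|) (fun _ _ => abs_nonneg _) (Finset.mem_univ s)
    | succ n ih =>
      by_cases hs : s ∈ B
      · simp [he0 n s hs, survival_succ_of_mem hs]
      · rw [he n s hs, survival_succ_of_notMem hs, Finset.mul_sum]
        refine (Finset.abs_sum_le_sum_abs _ _).trans (Finset.sum_le_sum fun s' _ => ?_)
        rw [abs_mul, abs_of_nonneg (hP.1 s s'), mul_left_comm]
        exact mul_le_mul_of_nonneg_left (ih s') (hP.1 s s')
  exact squeeze_zero_norm (hbound · s) (by simpa using (tendsto_survival hP hB s).const_mul C)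

end Killed

section Trajectory

variable {S : Type*}

/-- The left shift on trajectories. -/
def trajShift (ω : ℕ → S) : ℕ → S := fun n => ω (n + 1)

lemma measurable_trajShift [MeasurableSpace S] : Measurable (trajShift (S := S)) :=
  measurable_pi_lambda _ fun n => measurable_pi_apply (n + 1)

/-- The set of trajectories that agree with `w` up to time `n`. -/
def prefixCylinder (n : ℕ) (w : ℕ → S) : Set (ℕ → S) := {ω | ∀ i ≤ n, ω i = w i}

lemma measurableSet_prefixCylinder [MeasurableSpace S] [MeasurableSingletonClass S]
    (n : ℕ) (w : ℕ → S) :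
    MeasurableSet (prefixCylinder n w) := by
  have : prefixCylinder n w = ⋂ i ∈ Set.Iic n, (fun ω : ℕ → S => ω i) ⁻¹' {w i} := by
    ext; simp [prefixCylinder]
  rw [this]
  exact MeasurableSet.biInter (Set.to_countable _) fun i _ =>
    measurable_pi_apply i (measurableSet_singleton _)

lemma isPiSystem_prefixCylinder :
    IsPiSystem {A : Set (ℕ → S) | ∃ n w, A = prefixCylinder n w} := by
  rintro _ ⟨n, w, rfl⟩ _ ⟨m, u, rfl⟩ ⟨x, hxw, hxu⟩
  refine ⟨max n m, x, ?_⟩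
  ext ω
  constructor
  · rintro ⟨h1, h2⟩ i hi
    rcases le_max_iff.1 hi with h | h
    · rw [h1 i h, hxw i h]
    · rw [h2 i h, hxu i h]
  · exact fun h => ⟨fun i hi => (h i (le_max_of_le_left hi)).trans (hxw i hi),
      fun i hi => (h i (le_max_of_le_right hi)).trans (hxu i hi)⟩

lemma generateFrom_prefixCylinder [Finite S] [MeasurableSpace S] [MeasurableSingletonClass S] :
    MeasurableSpace.generateFrom {A : Set (ℕ → S) | ∃ n w, A = prefixCylinder n w} =
      MeasurableSpace.pi := by
  refine le_antisymm (MeasurableSpace.generateFrom_le ?_) (iSup_le fun i => ?_)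
  · rintro _ ⟨n, w, rfl⟩
    exact measurableSet_prefixCylinder n w
  · rintro _ ⟨A, -, rfl⟩
    have hfin : (Set.range fun ω : ℕ → S => prefixCylinder i ω).Finite := by
      refine (Set.finite_range fun u : Set.Iic i → S =>
        {ω : ℕ → S | ∀ j : Set.Iic i, ω j = u j}).subset ?_
      rintro _ ⟨w, rfl⟩
      exact ⟨fun j => w j, by ext; simp [prefixCylinder]⟩
    have hunion : (fun ω : ℕ → S => ω i) ⁻¹' A =
        ⋃₀ ((fun ω : ℕ → S => prefixCylinder i ω) '' ((fun ω : ℕ → S => ω i) ⁻¹' A)) := by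
      ext ω
      constructor
      · exact fun h => ⟨_, ⟨ω, h, rfl⟩, fun _ _ => rfl⟩
      · rintro ⟨_, ⟨w, hw, rfl⟩, h⟩
        simpa [h i le_rfl] using hw
    rw [hunion]
    refine MeasurableSet.sUnion (hfin.subset (Set.image_subset_range _ _)).countable ?_
    rintro _ ⟨w, -, rfl⟩
    exact MeasurableSpace.measurableSet_generateFrom ⟨i, w, rfl⟩

variable [DecidableEq S] [MeasurableSpace S] [MeasurableSingletonClass S]
  {P : Matrix S S ℝ} {μ : S → Measure (ℕ → S)}

/-- Under the trajectory measure the chain almost surely starts in its initial state. -/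
lemma ae_initial_eq (hμ : ∀ s, IsProbabilityMeasure (μ s))
    (hcyl : ∀ (s : S) (n : ℕ) (w : ℕ → S), μ s (prefixCylinder n w) =
      (if w 0 = s then 1 else 0) *
        ∏ i ∈ Finset.range n, ENNReal.ofReal (P (w i) (w (i + 1)))) (s : S) :
    ∀ᵐ ω ∂(μ s), ω 0 = s := by
  have := hμ s
  have h : μ s (prefixCylinder 0 fun _ => s) = 1 := by simpa using hcyl s 0 fun _ => s
  have h' := (prob_compl_eq_zero_iff (measurableSet_prefixCylinder _ _)).2 h
  filter_upwards [measure_eq_zero_iff_ae_notMem.1 h'] with ω hω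
  exact not_not.1 hω 0 le_rfl

/-- Markov property at time one. -/
lemma measure_trajShift_preimage [Fintype S] (hP : IsStochastic P)
    (hμ : ∀ s, IsProbabilityMeasure (μ s))
    (hcyl : ∀ (s : S) (n : ℕ) (w : ℕ → S), μ s (prefixCylinder n w) =
      (if w 0 = s then 1 else 0) *
        ∏ i ∈ Finset.range n, ENNReal.ofReal (P (w i) (w (i + 1)))) (s : S)
    {A : Set (ℕ → S)} (hA : MeasurableSet A) :
    μ s (trajShift ⁻¹' A) = ∑ s', ENNReal.ofReal (P s s') * μ s' A := by
  have hmap : (μ s).map trajShift = ∑ s', ENNReal.ofReal (P s s') • μ s' := by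
    have : IsProbabilityMeasure ((μ s).map trajShift) :=
      Measure.isProbabilityMeasure_map measurable_trajShift.aemeasurable
    refine ext_of_generate_finite _ generateFrom_prefixCylinder.symm isPiSystem_prefixCylinder
      ?_ ?_
    · rintro _ ⟨n, w, rfl⟩
      let u : ℕ → S := fun k => Nat.casesOn k s w
      have hae : trajShift ⁻¹' prefixCylinder n w =ᵐ[μ s] prefixCylinder (n + 1) u := by
        filter_upwards [ae_initial_eq hμ hcyl s] with ω hω
        refine propext ⟨fun h i hi => ?_, fun h i hi => h (i + 1) (by omega)⟩
        cases i with
        | zero => exact hω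
        | succ i => exact h i (by omega)
      rw [Measure.map_apply measurable_trajShift (measurableSet_prefixCylinder n w),
        measure_congr hae, hcyl, Finset.prod_range_succ']
      simp [hcyl, u, mul_comm]
    · simp [← ENNReal.ofReal_sum_of_nonneg fun s' _ => hP.1 s s', hP.2 s]
  rw [← Measure.map_apply measurable_trajShift hA, hmap]
  simp

end Trajectory

/-- Value iteration for reachability converges from an arbitrary initial vector:
if `v (n+1) s = 1` for `s ∈ T`, `v (n+1) s = 0` for `s` in the set `S₀` of
states with no path to `T`, and `v (n+1) s = ∑_{s'} P s s' · v n s'` otherwise,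
then `v n s → ℙ_s(◇T)` for every state `s`. The measure `μ s` is the canonical
trajectory measure started at `s`, characterized on cylinder sets. -/
theorem stmt17 {S : Type*} [Fintype S] [DecidableEq S] [Nonempty S]
    [MeasurableSpace S] [MeasurableSingletonClass S]
    (P : Matrix S S ℝ) (hP : IsStochastic P)
    (μ : S → Measure (ℕ → S)) (hμ : ∀ s, IsProbabilityMeasure (μ s))
    (hcyl : ∀ (s : S) (n : ℕ) (w : ℕ → S),
      μ s {ω | ∀ i ≤ n, ω i = w i} =
        (if w 0 = s then 1 else 0) *
          ∏ i ∈ Finset.range n, ENNReal.ofReal (P (w i) (w (i + 1))))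
    (T : Set S)
    (v : ℕ → S → ℝ)
    (hv : ∀ n : ℕ,
      (∀ s ∈ T, v (n + 1) s = 1) ∧
      (∀ s : S, (∀ t ∈ T, ¬ Relation.ReflTransGen (fun x y => 0 < P x y) s t) →
        v (n + 1) s = 0) ∧
      (∀ s : S, s ∉ T →
        (∃ t ∈ T, Relation.ReflTransGen (fun x y => 0 < P x y) s t) →
        v (n + 1) s = ∑ s', P s s' * v n s')) :
    ∀ s : S,
      Tendsto (fun n : ℕ => v n s) atTop
        (𝓝 ((μ s {ω | ∃ n : ℕ, ω n ∈ T}).toReal)) := by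
  have hcyl' : ∀ (s : S) (n : ℕ) (w : ℕ → S), μ s (prefixCylinder n w) =
      (if w 0 = s then 1 else 0) *
        ∏ i ∈ Finset.range n, ENNReal.ofReal (P (w i) (w (i + 1))) := hcyl
  have hT (n : ℕ) : MeasurableSet {ω : ℕ → S | ω n ∈ T} :=
    measurable_pi_apply n (Set.toFinite T).measurableSet
  have hmeas : MeasurableSet {ω : ℕ → S | ∃ n, ω n ∈ T} := by
    simpa only [Set.ofPred_exists] using MeasurableSet.iUnion hT
  set h : S → ℝ := fun s => (μ s {ω | ∃ n, ω n ∈ T}).toReal with h_def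
  have h_target : ∀ s ∈ T, h s = 1 := by
    intro s hs
    have : {ω : ℕ → S | ∃ n, ω n ∈ T} =ᵐ[μ s] Set.univ := by
      filter_upwards [ae_initial_eq hμ hcyl' s] with ω hω
      exact propext ⟨fun _ => trivial, fun _ => ⟨0, hω ▸ hs⟩⟩
    simp [h_def, measure_congr this]
  have h_unreachable : ∀ s : S,
      (∀ t ∈ T, ¬ Relation.ReflTransGen (fun x y => 0 < P x y) s t) → h s = 0 := by
    have hzero (n : ℕ) : ∀ s : S,
        (∀ t ∈ T, ¬ Relation.ReflTransGen (fun x y => 0 < P x y) s t) →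
          μ s {ω | ω n ∈ T} = 0 := by
      induction n with
      | zero =>
        intro s hs
        refine measure_eq_zero_iff_ae_notMem.2 ?_
        filter_upwards [ae_initial_eq hμ hcyl' s] with ω hω hmem
        exact hs s (by simpa [hω] using hmem) .refl
      | succ n ih =>
        intro s hs
        refine (measure_trajShift_preimage hP hμ hcyl' s (hT n)).trans ?_
        refine Finset.sum_eq_zero fun s' _ => ?_
        rcases (hP.1 s s').eq_or_lt with h0 | h0
        · simp [← h0]
        · rw [ih s' fun t ht hst => hs t ht (.head h0 hst), mul_zero]
    intro s hs
    simp only [h_def, Set.ofPred_exists, measure_iUnion_null fun n => hzero n s hs,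
      ENNReal.toReal_zero]
  have h_step : ∀ s ∉ T, h s = ∑ s', P s s' * h s' := by
    intro s hs
    have hae : {ω : ℕ → S | ∃ n, ω n ∈ T} =ᵐ[μ s] trajShift ⁻¹' {ω | ∃ n, ω n ∈ T} := by
      filter_upwards [ae_initial_eq hμ hcyl' s] with ω hω
      refine propext ⟨?_, fun ⟨n, hn⟩ => ⟨n + 1, hn⟩⟩
      rintro ⟨_ | n, hn⟩
      · exact absurd (hω ▸ hn) hs
      · exact ⟨n, hn⟩
    simp only [h_def]
    rw [measure_congr hae, measure_trajShift_preimage hP hμ hcyl' s hmeas,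
      ENNReal.toReal_sum fun s' _ => ENNReal.mul_ne_top ENNReal.ofReal_ne_top (measure_ne_top _ _)]
    simp [ENNReal.toReal_ofReal (hP.1 s _)]
  intro s
  let U : Set S := {s | ∀ t ∈ T, ¬ Relation.ReflTransGen (fun x y => 0 < P x y) s t}
  have herr := tendsto_zero_of_killed_iterate hP (B := T ∪ U) (e := fun n s => v n s - h s)
    (fun s => by
      by_cases hs : s ∈ U
      · exact ⟨s, .inr hs, .refl⟩
      · obtain ⟨t, ht, hst⟩ : ∃ t ∈ T, Relation.ReflTransGen (fun x y => 0 < P x y) s t := by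
          simpa [U] using hs
        exact ⟨t, .inl ht, hst⟩)
    (fun n s hs => by
      rcases hs with hs | hs
      · simp [(hv n).1 s hs, h_target s hs]
      · simp [(hv n).2.1 s hs, h_unreachable s hs])
    (fun n s hs => by
      have hsT : s ∉ T := fun h => hs (.inl h)
      have hsU : s ∉ U := fun h => hs (.inr h)
      rw [(hv n).2.2 s hsT (by simpa [U] using hsU), h_step s hsT, ← Finset.sum_sub_distrib]
      exact Finset.sum_congr rfl fun s' _ => (mul_sub _ _ _).symm) s
  simpa using herr.add_const (h s)
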